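/- arXiv:1108.3118 — 2 statements merged into one kernel-verified Lean document; each statement's English description precedes it below -/
import Mathlib

section
/- Let N ≥ 1, p > 0, and let ω₁, ω₂ : ℝ^N → ℝ be smooth positive functions. Suppose there exists t with 0 < t < p + √(p(p+1)) such that I_M(R) → 0 as R → ∞, where I_M(R) = R^{-2(p+2t+1)/(p+1)} ∫_{R<|x|<2R} (ω₁^{p+2t+1}/ω₂^{2t})^{1/(p+1)} dx. Then there is no positive stable super-solution of the equation −div(ω₁ ∇u) = −ω₂ u^{−p} in ℝ^N. -/
open MeasureTheory Filter Real
open scoped RealInnerProductSpace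

noncomputable def vdiv {N : ℕ} (V : EuclideanSpace ℝ (Fin N) → EuclideanSpace ℝ (Fin N))
    (x : EuclideanSpace ℝ (Fin N)) : ℝ :=
  LinearMap.trace ℝ (EuclideanSpace ℝ (Fin N)) (fderiv ℝ V x).toLinearMap

def annulus (N : ℕ) (R : ℝ) : Set (EuclideanSpace ℝ (Fin N)) :=
  {x | R < ‖x‖ ∧ ‖x‖ < 2 * R}

theorem integral_fderiv_apply_eq_zero {N : ℕ} {f : EuclideanSpace ℝ (Fin N) → ℝ}
    (hf : ContDiff ℝ 1 f) (hc : HasCompactSupport f) (v : EuclideanSpace ℝ (Fin N)) :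
    ∫ x, fderiv ℝ f x v = 0 := by
  have hi : Integrable (fun x => fderiv ℝ f x v) :=
    ((hf.continuous_fderiv one_ne_zero).clm_apply continuous_const).integrable_of_hasCompactSupport
      (hc.fderiv_apply (𝕜 := ℝ) v)
  have h := integral_mul_fderiv_eq_neg_fderiv_mul_of_integrable (μ := volume) (f := f)
    (g := fun _ => (1 : ℝ)) (v := v) (by simpa using hi) (by simp)
    (by simpa using hf.continuous.integrable_of_hasCompactSupport hc)
    (fun x _ => hf.differentiable one_ne_zero x) (fun x _ => differentiableAt_const _)
  simpa using h

theorem vdiv_eq_sum {N : ℕ} {V : EuclideanSpace ℝ (Fin N) → EuclideanSpace ℝ (Fin N)}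
    (hV : Differentiable ℝ V) (x : EuclideanSpace ℝ (Fin N)) :
    vdiv V x = ∑ i, fderiv ℝ (fun y => V y i) x (EuclideanSpace.basisFun (Fin N) ℝ i) := by
  rw [vdiv, LinearMap.trace_eq_sum_inner _ (EuclideanSpace.basisFun (Fin N) ℝ)]
  refine Finset.sum_congr rfl fun i _ => ?_
  have h := (((EuclideanSpace.proj i : EuclideanSpace ℝ (Fin N) →L[ℝ] ℝ).hasFDerivAt).comp x
    (hV x).hasFDerivAt).fderiv
  rw [show (fun y => V y i) =
    (EuclideanSpace.proj i : EuclideanSpace ℝ (Fin N) →L[ℝ] ℝ) ∘ V from rfl, h]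
  simp [EuclideanSpace.inner_single_left]

theorem continuous_vdiv {N : ℕ} {V : EuclideanSpace ℝ (Fin N) → EuclideanSpace ℝ (Fin N)}
    (hV : ContDiff ℝ 1 V) : Continuous (vdiv V) := by
  have h : vdiv V = fun x =>
      ∑ i, fderiv ℝ (fun y => V y i) x (EuclideanSpace.basisFun (Fin N) ℝ i) :=
    funext (vdiv_eq_sum (hV.differentiable one_ne_zero))
  rw [h]
  refine continuous_finsetSum _ fun i _ => ?_
  have hi : ContDiff ℝ 1 fun y => V y i :=
    (EuclideanSpace.proj i : EuclideanSpace ℝ (Fin N) →L[ℝ] ℝ).contDiff.comp hV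
  exact (hi.continuous_fderiv one_ne_zero).clm_apply continuous_const

theorem hasCompactSupport_vdiv {N : ℕ}
    {V : EuclideanSpace ℝ (Fin N) → EuclideanSpace ℝ (Fin N)} (hc : HasCompactSupport V) :
    HasCompactSupport (vdiv V) :=
  (hc.fderiv ℝ).comp_left (g := fun A : EuclideanSpace ℝ (Fin N) →L[ℝ] EuclideanSpace ℝ (Fin N) =>
    LinearMap.trace ℝ (EuclideanSpace ℝ (Fin N)) A.toLinearMap) (by simp)

theorem integral_vdiv_eq_zero {N : ℕ} {V : EuclideanSpace ℝ (Fin N) → EuclideanSpace ℝ (Fin N)}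
    (hV : ContDiff ℝ 1 V) (hc : HasCompactSupport V) : ∫ x, vdiv V x = 0 := by
  have hi (i : Fin N) : ContDiff ℝ 1 fun y => V y i :=
    (EuclideanSpace.proj i : EuclideanSpace ℝ (Fin N) →L[ℝ] ℝ).contDiff.comp hV
  have hci (i : Fin N) : HasCompactSupport fun y => V y i :=
    hc.comp_left (g := fun v : EuclideanSpace ℝ (Fin N) => v i) rfl
  simp_rw [vdiv_eq_sum (hV.differentiable one_ne_zero)]
  rw [integral_finsetSum]
  · exact Finset.sum_eq_zero fun i _ => integral_fderiv_apply_eq_zero (hi i) (hci i) _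
  · intro i _
    exact (((hi i).continuous_fderiv one_ne_zero).clm_apply
      continuous_const).integrable_of_hasCompactSupport ((hci i).fderiv_apply (𝕜 := ℝ) _)

theorem vdiv_smul {N : ℕ} {g : EuclideanSpace ℝ (Fin N) → ℝ}
    {V : EuclideanSpace ℝ (Fin N) → EuclideanSpace ℝ (Fin N)} {x : EuclideanSpace ℝ (Fin N)}
    (hg : DifferentiableAt ℝ g x) (hV : DifferentiableAt ℝ V x) :
    vdiv (fun y => g y • V y) x = g x * vdiv V x + ⟪gradient g x, V x⟫ := by
  rw [vdiv, fderiv_fun_smul hg hV, inner_gradient_left, vdiv]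
  have h := LinearMap.trace_smulRight (fderiv ℝ g x).toLinearMap (V x)
  simp only [ContinuousLinearMap.toLinearMap_add, ContinuousLinearMap.toLinearMap_smul, map_add,
    map_smul, smul_eq_mul]
  congr 1

theorem contDiff_gradient {N : ℕ} {u : EuclideanSpace ℝ (Fin N) → ℝ} (hu : ContDiff ℝ 2 u) :
    ContDiff ℝ 1 (gradient u) :=
  (InnerProductSpace.toDual ℝ (EuclideanSpace ℝ (Fin N))).symm.contDiff.comp
    (hu.fderiv_right (m := 1) (by norm_num))

theorem gradient_rpow_mul_pow {N : ℕ} {u η : EuclideanSpace ℝ (Fin N) → ℝ}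
    {x : EuclideanSpace ℝ (Fin N)} (hu : DifferentiableAt ℝ u x) (hη : DifferentiableAt ℝ η x)
    (hpos : 0 < u x) (s : ℝ) (m : ℕ) :
    gradient (fun y => u y ^ s * η y ^ m) x =
      (s * u x ^ (s - 1) * η x ^ m) • gradient u x +
        (u x ^ s * (m * η x ^ (m - 1))) • gradient η x := by
  have h1 := hu.hasFDerivAt.rpow_const (p := s) (Or.inl hpos.ne')
  have h := (h1.mul (hη.hasFDerivAt.pow m)).fderiv
  have h' : gradient (fun y => u y ^ s * η y ^ m) x =
    (InnerProductSpace.toDual ℝ _).symm (fderiv ℝ (fun y => u y ^ s * η y ^ m) x) := rfl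
  rw [h', show (fun y => u y ^ s * η y ^ m) = (fun y => u y ^ s) * (fun y => η y ^ m) from rfl,
    h]
  simp only [map_add, map_smulₛₗ, gradient, smul_smul, nsmul_eq_mul]
  simp only [conj_trivial]
  rw [add_comm]
  congr 2
  ring

theorem exists_cutoff (N : ℕ) : ∃ L : ℝ, 0 ≤ L ∧ ∀ R : ℝ, 0 < R →
    ∃ η : EuclideanSpace ℝ (Fin N) → ℝ, ContDiff ℝ 2 η ∧ HasCompactSupport η ∧
      (∀ x, 0 ≤ η x) ∧ (∀ x, η x ≤ 1) ∧ (∀ x, ‖x‖ ≤ R → η x = 1) ∧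
      (∀ x, ‖gradient η x‖ ≤ L / R) ∧ ∀ x, x ∉ annulus N R → gradient η x = 0 := by
  let χ : ContDiffBump (0 : EuclideanSpace ℝ (Fin N)) := ⟨1, 2, one_pos, one_lt_two⟩
  have hχ : ContDiff ℝ 2 χ := χ.contDiff
  obtain ⟨L, hL⟩ := (hχ.continuous_fderiv two_ne_zero).bounded_above_of_compact_support
    (χ.hasCompactSupport.fderiv ℝ)
  refine ⟨L, (norm_nonneg _).trans (hL 0), fun R hR => ?_⟩
  have hd (x) : fderiv ℝ (fun y => χ (R⁻¹ • y)) x = R⁻¹ • fderiv ℝ χ (R⁻¹ • x) :=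
    fderiv_comp_smul R⁻¹
  have hone (x : EuclideanSpace ℝ (Fin N)) (hx : ‖x‖ ≤ R) : χ (R⁻¹ • x) = 1 := by
    apply χ.one_of_mem_closedBall
    rw [mem_closedBall_zero_iff, norm_smul, norm_inv, Real.norm_of_nonneg hR.le]
    exact (inv_mul_le_one₀ hR).2 hx
  have hzero (x : EuclideanSpace ℝ (Fin N)) (hx : 2 * R ≤ ‖x‖) : χ (R⁻¹ • x) = 0 := by
    apply χ.zero_of_le_dist
    rw [dist_zero_right, norm_smul, norm_inv, Real.norm_of_nonneg hR.le, inv_mul_eq_div]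
    exact (le_div_iff₀ hR).2 hx
  refine ⟨fun x => χ (R⁻¹ • x), hχ.comp (contDiff_const_smul _), ?_, fun x => χ.nonneg,
    fun x => χ.le_one, hone, fun x => ?_, fun x hx => ?_⟩
  · exact χ.hasCompactSupport.comp_smul (inv_ne_zero hR.ne')
  · rw [gradient, LinearIsometryEquiv.norm_map, hd, norm_smul, norm_inv,
      Real.norm_of_nonneg hR.le, inv_mul_eq_div]
    exact div_le_div_of_nonneg_right (hL _) hR.le
  · rw [gradient]
    suffices h : fderiv ℝ (fun y => χ (R⁻¹ • y)) x = 0 by rw [h, map_zero]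
    rcases le_or_gt ‖x‖ R with h | h
    · refine IsLocalMax.fderiv_eq_zero (Eventually.of_forall fun y => ?_)
      simp only [hone x h]
      exact χ.le_one
    · refine IsLocalMin.fderiv_eq_zero (Eventually.of_forall fun y => ?_)
      simp only [hzero x (not_lt.1 fun h2 => hx ⟨h, h2⟩)]
      exact χ.nonneg

theorem Real.exists_mul_le_rpow_add_rpow {q q' : ℝ} (hq : q.HolderConjugate q') {ε : ℝ}
    (hε : 0 < ε) :
    ∃ C : ℝ, 0 ≤ C ∧ ∀ X Y : ℝ, 0 ≤ X → 0 ≤ Y → X * Y ≤ ε * X ^ q + C * Y ^ q' := by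
  set s := (ε * q) ^ q⁻¹
  have hs : 0 < s := rpow_pos_of_pos (mul_pos hε hq.pos) _
  have hsq : s ^ q = ε * q := rpow_inv_rpow (mul_pos hε hq.pos).le hq.ne_zero
  refine ⟨s⁻¹ ^ q' / q', div_nonneg (rpow_nonneg (inv_nonneg.2 hs.le) _) hq.symm.nonneg,
    fun X Y hX hY => ?_⟩
  have h := young_inequality_of_nonneg (mul_nonneg hs.le hX)
    (mul_nonneg (inv_nonneg.2 hs.le) hY) hq
  rw [mul_rpow hs.le hX, mul_rpow (inv_nonneg.2 hs.le) hY, hsq] at h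
  calc X * Y = s * X * (s⁻¹ * Y) := by field_simp
    _ ≤ _ := h
    _ = _ := by have := hq.ne_zero; field_simp

theorem exists_weighted_young {p t : ℝ} (hp : 0 < p) (ht : 0 < t) {K δ : ℝ} (hK : 0 < K)
    (hδ : 0 < δ) {m : ℕ} (hm : (p + 2 * t + 1) / (p + 1) ≤ m) :
    ∃ C : ℝ, 0 ≤ C ∧ ∀ a b v h G : ℝ, 0 < a → 0 < b → 0 < v → 0 ≤ h → h ≤ 1 → 0 ≤ G →
      K * (a * (v ^ (-t) * (m * h ^ (m - 1)) * G) ^ 2) ≤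
        δ * (b * v ^ (-p - 1) * (v ^ (-t) * h ^ m) ^ 2) +
          C * ((a ^ (p + 2 * t + 1) / b ^ (2 * t)) ^ (1 / (p + 1)) *
            G ^ (2 * (p + 2 * t + 1) / (p + 1))) := by
  set q := (p + 2 * t + 1) / (2 * t) with hqdef
  set q' := (p + 2 * t + 1) / (p + 1) with hq'def
  have hq : q.HolderConjugate q' := by
    rw [Real.holderConjugate_iff]
    refine ⟨?_, ?_⟩
    · rw [hqdef, one_lt_div (by positivity)]; linarith
    · rw [hqdef, hq'def]; field_simp; ring
  have hm1 : (1 : ℝ) < m := hq.symm.lt.trans_le hm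
  have hm1' : 1 ≤ m := by exact_mod_cast hm1.le
  obtain ⟨C, hC, hCy⟩ := Real.exists_mul_le_rpow_add_rpow hq
    (ε := δ / (K * m ^ 2)) (by positivity)
  refine ⟨K * m ^ 2 * C, by positivity, fun a b v h G ha hb hv h0 h1 hG => ?_⟩
  have hX : (b ^ q⁻¹ * (v ^ (-t)) ^ 2 * (h ^ (m - 1)) ^ 2) ^ q ≤
      b * v ^ (-p - 1) * (v ^ (-t) * h ^ m) ^ 2 := by
    have hvq : ((v ^ (-t)) ^ 2) ^ q = v ^ (-p - 1) * (v ^ (-t)) ^ 2 := by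
      simp only [← rpow_natCast, ← rpow_mul hv.le]
      rw [← rpow_add hv]
      congr 1
      rw [hqdef]
      push_cast
      field_simp
      ring
    have hhq : ((h ^ (m - 1)) ^ 2) ^ q ≤ (h ^ m) ^ 2 := by
      rw [← pow_mul, ← pow_mul, ← rpow_natCast, ← rpow_mul h0, ← rpow_natCast]
      have hle : ((m * 2 : ℕ) : ℝ) ≤ (((m - 1) * 2 : ℕ) : ℝ) * q := by
        push_cast [Nat.cast_sub hm1']
        have hqq : q' * (q - 1) = q := by rw [hqdef, hq'def]; field_simp; ring
        nlinarith [mul_le_mul_of_nonneg_right hm hq.sub_one_pos.le]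
      exact rpow_le_rpow_of_exponent_ge_of_imp h0 h1 hle (fun _ h' => by
        have : (0:ℝ) < ((m * 2 : ℕ) : ℝ) := by positivity
        linarith)
    rw [mul_rpow (by positivity) (by positivity), mul_rpow (by positivity) (by positivity),
      rpow_inv_rpow hb.le hq.ne_zero, hvq, mul_pow, mul_assoc b, mul_assoc b, mul_assoc (v ^ _)]
    gcongr
  have hY : (a * b ^ (-q⁻¹) * G ^ 2) ^ q' =
      (a ^ (p + 2 * t + 1) / b ^ (2 * t)) ^ (1 / (p + 1)) *
        G ^ (2 * (p + 2 * t + 1) / (p + 1)) := by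
    rw [mul_rpow (by positivity) (by positivity), mul_rpow ha.le (by positivity),
      div_rpow (by positivity) (by positivity), ← rpow_natCast G, ← rpow_mul hG, ← rpow_mul hb.le,
      ← rpow_mul ha.le, ← rpow_mul hb.le, div_eq_mul_inv, ← rpow_neg hb.le]
    have e1 : q' = (p + 2 * t + 1) * (1 / (p + 1)) := by rw [hq'def]; ring
    have e2 : -q⁻¹ * q' = -(2 * t * (1 / (p + 1))) := by rw [hqdef, hq'def]; field_simp
    have e3 : ((2 : ℕ) : ℝ) * q' = 2 * (p + 2 * t + 1) / (p + 1) := by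
      rw [hq'def]; push_cast; ring
    rw [e2, e3, ← e1]
  have hmain := hCy (b ^ q⁻¹ * (v ^ (-t)) ^ 2 * (h ^ (m - 1)) ^ 2) (a * b ^ (-q⁻¹) * G ^ 2)
    (by positivity) (by positivity)
  rw [hY] at hmain
  have hbb : b ^ q⁻¹ * b ^ (-q⁻¹) = 1 := by rw [← rpow_add hb]; simp
  calc K * (a * (v ^ (-t) * (m * h ^ (m - 1)) * G) ^ 2)
      = K * m ^ 2 * (b ^ q⁻¹ * (v ^ (-t)) ^ 2 * (h ^ (m - 1)) ^ 2 *
          (a * b ^ (-q⁻¹) * G ^ 2)) := by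
        linear_combination (-K * m ^ 2 * (v ^ (-t)) ^ 2 * (h ^ (m - 1)) ^ 2 * a * G ^ 2) * hbb
    _ ≤ K * m ^ 2 * (δ / (K * m ^ 2) * (b * v ^ (-p - 1) * (v ^ (-t) * h ^ m) ^ 2) +
          C * ((a ^ (p + 2 * t + 1) / b ^ (2 * t)) ^ (1 / (p + 1)) *
            G ^ (2 * (p + 2 * t + 1) / (p + 1)))) := by
        gcongr
        exact hmain.trans (by gcongr)
    _ = _ := by field_simp

theorem norm_sq_combination_le {E : Type*} [NormedAddCommGroup E] [InnerProductSpace ℝ E]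
    {t l : ℝ} (hl : t ^ 2 < l * (2 * t + 1)) (ξ ζ : E) :
    ‖(-t) • ξ + ζ‖ ^ 2 + l * (-(2 * t + 1) * ‖ξ‖ ^ 2 + 2 * ⟪ξ, ζ⟫) ≤
      (1 + (l - t) ^ 2 / (l * (2 * t + 1) - t ^ 2)) * ‖ζ‖ ^ 2 := by
  have hε : 0 < l * (2 * t + 1) - t ^ 2 := sub_pos.2 hl
  have h := norm_sub_sq_real ((l * (2 * t + 1) - t ^ 2) • ξ) ((l - t) • ζ)
  have h' := norm_add_sq_real ((-t) • ξ) ζ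
  simp only [norm_smul, mul_pow, inner_smul_left, inner_smul_right, Real.norm_eq_abs, sq_abs,
    conj_trivial] at h h'
  rw [h', ← sub_nonneg]
  have h0 := div_nonneg (h ▸ sq_nonneg ‖(l * (2 * t + 1) - t ^ 2) • ξ - (l - t) • ζ‖) hε.le
  generalize hεdef : l * (2 * t + 1) - t ^ 2 = ε at *
  refine h0.trans_eq ?_
  have hcancel : (l - t) ^ 2 / ε * ε = (l - t) ^ 2 := div_mul_cancel₀ _ hε.ne'
  rw [div_eq_iff hε.ne']
  linear_combination -(ε * ‖ξ‖ ^ 2) * hεdef - ‖ζ‖ ^ 2 * hcancel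

theorem stability_integrand_le {N : ℕ} {ω₁ ω₂ u η : EuclideanSpace ℝ (Fin N) → ℝ} {p t l : ℝ}
    (hω₁ : ContDiff ℝ 1 ω₁) (hω₁pos : ∀ x, 0 < ω₁ x) (hu : ContDiff ℝ 2 u)
    (hupos : ∀ x, 0 < u x) (hη : ContDiff ℝ 2 η)
    (hsup : ∀ x, -(ω₂ x * u x ^ (-p)) ≤ -vdiv (fun y => ω₁ y • gradient u y) x)
    (hl0 : 0 ≤ l) (hl : t ^ 2 < l * (2 * t + 1)) {m : ℕ} (hm : 1 ≤ m)
    (x : EuclideanSpace ℝ (Fin N)) :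
    ω₁ x * ‖gradient (fun y => u y ^ (-t) * η y ^ m) x‖ ^ 2 -
        p * ω₂ x * u x ^ (-p - 1) * (u x ^ (-t) * η x ^ m) ^ 2 +
      l * vdiv (fun y => (u y ^ (-(2 * t + 1)) * η y ^ (2 * m)) • ω₁ y • gradient u y) x ≤
    -(p - l) * (ω₂ x * u x ^ (-p - 1) * (u x ^ (-t) * η x ^ m) ^ 2) +
      (1 + (l - t) ^ 2 / (l * (2 * t + 1) - t ^ 2)) *
        (ω₁ x * (u x ^ (-t) * (m * η x ^ (m - 1)) * ‖gradient η x‖) ^ 2) := by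
  have hux := hupos x
  have hud : DifferentiableAt ℝ u x := hu.differentiable two_ne_zero x
  have hηd : DifferentiableAt ℝ η x := hη.differentiable two_ne_zero x
  have hVd : DifferentiableAt ℝ (fun y => ω₁ y • gradient u y) x :=
    (hω₁.smul (contDiff_gradient hu)).differentiable one_ne_zero x
  have hgd : DifferentiableAt ℝ (fun y => u y ^ (-(2 * t + 1)) * η y ^ (2 * m)) x :=
    (hud.rpow_const (Or.inl hux.ne')).mul (hηd.pow _)
  rw [vdiv_smul hgd hVd, gradient_rpow_mul_pow hud hηd hux, gradient_rpow_mul_pow hud hηd hux]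
  have e1 : u x ^ (-t - 1) = u x ^ (-t) / u x := by rw [rpow_sub_one hux.ne']
  have e2 : u x ^ (-(2 * t + 1)) = (u x ^ (-t)) ^ 2 / u x := by
    rw [show -(2 * t + 1) = -t + -t - 1 by ring, rpow_sub_one hux.ne', rpow_add hux, sq]
  have e3 : u x ^ (-p) = u x ^ (-p - 1) * u x := by
    rw [rpow_sub_one hux.ne', div_mul_cancel₀ _ hux.ne']
  have e4 : η x ^ (2 * m) = (η x ^ m) ^ 2 := by rw [mul_comm, pow_mul]
  have e5 : η x ^ (2 * m - 1) = η x ^ m * η x ^ (m - 1) := by rw [← pow_add]; congr 1; omega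
  have hs := hsup x
  have hcomb := norm_sq_combination_le hl ((u x ^ (-t) / u x * η x ^ m) • gradient u x)
    ((u x ^ (-t) * (m * η x ^ (m - 1))) • gradient η x)
  rw [smul_smul, show -t * (u x ^ (-t) / u x * η x ^ m) = -t * u x ^ (-t - 1) * η x ^ m by
    rw [e1]; ring] at hcomb
  rw [rpow_sub_one hux.ne' (-(2 * t + 1)), e2, e4, e5]
  rw [e3] at hs
  generalize vdiv (fun y => ω₁ y • gradient u y) x = d at *
  generalize u x ^ (-p - 1) = Q at *
  generalize hX : ‖(-t * u x ^ (-t - 1) * η x ^ m) • gradient u x +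
    (u x ^ (-t) * (m * η x ^ (m - 1))) • gradient η x‖ ^ 2 = X at *
  generalize u x ^ (-t) = P at *
  generalize η x ^ m = H at *
  generalize η x ^ (m - 1) = H' at *
  generalize (1 + (l - t) ^ 2 / (l * (2 * t + 1) - t ^ 2)) = K at *
  simp only [inner_add_left, inner_smul_left, inner_smul_right, norm_smul, mul_pow, conj_trivial,
    Real.norm_eq_abs, sq_abs, real_inner_self_eq_norm_sq] at hcomb ⊢
  rw [real_inner_comm (gradient u x) (gradient η x)]
  generalize ⟪gradient u x, gradient η x⟫ = I at *
  have h1 := mul_le_mul_of_nonneg_left hcomb (hω₁pos x).le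
  have h2 := mul_le_mul_of_nonneg_left hs
    (show 0 ≤ l * (P ^ 2 / u x * H ^ 2) by positivity)
  have h3 : l * (P ^ 2 / u x * H ^ 2) * (ω₂ x * (Q * u x)) = l * (ω₂ x * Q * (P * H) ^ 2) := by
    field_simp
  push_cast
  linear_combination h1 + h2 + h3

theorem setIntegral_closedBall_le_mul_setIntegral_annulus {N : ℕ}
    {ω₁ ω₂ u : EuclideanSpace ℝ (Fin N) → ℝ} {p t : ℝ}
    (hp : 0 < p) (ht1 : 0 < t) (ht2 : t < p + √(p * (p + 1)))
    (hω₁ : ContDiff ℝ 1 ω₁) (hω₂ : Continuous ω₂)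
    (hω₁pos : ∀ x, 0 < ω₁ x) (hω₂pos : ∀ x, 0 < ω₂ x)
    (hu : ContDiff ℝ 2 u) (hupos : ∀ x, 0 < u x)
    (hsup : ∀ x, -(ω₂ x * u x ^ (-p)) ≤ -vdiv (fun y => ω₁ y • gradient u y) x)
    (hstab : ∀ ψ : EuclideanSpace ℝ (Fin N) → ℝ, ContDiff ℝ 2 ψ → HasCompactSupport ψ →
      ∫ x, p * ω₂ x * u x ^ (-p - 1) * ψ x ^ 2 ≤ ∫ x, ω₁ x * ‖gradient ψ x‖ ^ 2) :
    ∃ C : ℝ, ∀ R : ℝ, 1 ≤ R →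
      ∫ x in Metric.closedBall 0 1, ω₂ x * u x ^ (-p - 1) * (u x ^ (-t)) ^ 2 ≤
        C * (R ^ (-2 * (p + 2 * t + 1) / (p + 1)) *
          ∫ x in annulus N R, (ω₁ x ^ (p + 2 * t + 1) / ω₂ x ^ (2 * t)) ^ (1 / (p + 1))) := by
  have ht2' : t ^ 2 < p * (2 * t + 1) := by
    have hs := Real.sq_sqrt (show 0 ≤ p * (p + 1) by positivity)
    have hs0 := Real.sqrt_nonneg (p * (p + 1))
    have hps : p < √(p * (p + 1)) := Real.lt_sqrt_of_sq_lt (by nlinarith)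
    nlinarith [mul_pos (sub_pos.2 ht2) (show 0 < t - p + √(p * (p + 1)) by linarith)]
  have htp : t ^ 2 / (2 * t + 1) < p := (div_lt_iff₀ (by positivity)).2 ht2'
  obtain ⟨l, hl1, hlp⟩ := exists_between htp
  have hl0 : 0 ≤ l := le_trans (by positivity) hl1.le
  have hl : t ^ 2 < l * (2 * t + 1) := (div_lt_iff₀ (by positivity)).1 hl1
  set K := 1 + (l - t) ^ 2 / (l * (2 * t + 1) - t ^ 2)
  have hK : 0 < K := by have := sub_pos.2 hl; positivity
  have hδ : 0 < (p - l) / 2 := by linarith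
  obtain ⟨C, hC, hyoung⟩ := exists_weighted_young hp ht1 hK hδ
    (Nat.le_ceil ((p + 2 * t + 1) / (p + 1)))
  set m := ⌈(p + 2 * t + 1) / (p + 1)⌉₊
  have hm : 1 ≤ m := Nat.ceil_pos.2 (by positivity)
  obtain ⟨L, hL, hcut⟩ := exists_cutoff N
  set e := 2 * (p + 2 * t + 1) / (p + 1) with he
  have he0 : 0 < e := by positivity
  refine ⟨((p - l) / 2)⁻¹ * (C * L ^ e), fun R hR => ?_⟩
  have hR0 : 0 < R := one_pos.trans_le hR
  obtain ⟨η, hη, hηc, hη0, hη1, hηR, hηL, hηann⟩ := hcut R hR0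
  set M : EuclideanSpace ℝ (Fin N) → ℝ :=
    fun x => (ω₁ x ^ (p + 2 * t + 1) / ω₂ x ^ (2 * t)) ^ (1 / (p + 1))
  set a : EuclideanSpace ℝ (Fin N) → ℝ :=
    fun x => ω₂ x * u x ^ (-p - 1) * (u x ^ (-t) * η x ^ m) ^ 2 with ha_def
  have hupow (s : ℝ) : ContDiff ℝ 2 fun x => u x ^ s :=
    hu.rpow_const_of_ne fun x => (hupos x).ne'
  have hηpow (k : ℕ) (hk : k ≠ 0) : HasCompactSupport fun x => η x ^ k :=
    hηc.comp_left (g := fun y : ℝ => y ^ k) (zero_pow hk)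
  have hψ : ContDiff ℝ 2 fun x => u x ^ (-t) * η x ^ m := (hupow _).mul (hη.pow _)
  have hψc : HasCompactSupport fun x => u x ^ (-t) * η x ^ m :=
    (hηpow m (by omega)).mul_left
  have hMcont : Continuous M := by
    refine Continuous.rpow_const (Continuous.div ?_ ?_ fun x => ?_) fun x => Or.inr (by positivity)
    · exact hω₁.continuous.rpow_const fun x => Or.inl (hω₁pos x).ne'
    · exact hω₂.rpow_const fun x => Or.inl (hω₂pos x).ne'
    · exact (rpow_pos_of_pos (hω₂pos x) _).ne'
  have hM0 (x) : 0 ≤ M x :=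
    rpow_nonneg (div_nonneg (rpow_nonneg (hω₁pos x).le _) (rpow_nonneg (hω₂pos x).le _)) _
  have hacont : Continuous a := (hω₂.mul (hupow _).continuous).mul (hψ.continuous.pow 2)
  have hψc2 : HasCompactSupport fun x => (u x ^ (-t) * η x ^ m) ^ 2 :=
    hψc.comp_left (g := fun y : ℝ => y ^ 2) (zero_pow two_ne_zero)
  have haint : Integrable a := hacont.integrable_of_hasCompactSupport hψc2.mul_left
  have ha0 (x) : 0 ≤ a x :=
    mul_nonneg (mul_nonneg (hω₂pos x).le (rpow_nonneg (hupos x).le _)) (sq_nonneg _)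
  have hannm : MeasurableSet (annulus N R) :=
    (measurableSet_lt measurable_const measurable_norm).inter
      (measurableSet_lt measurable_norm measurable_const)
  have hMint : IntegrableOn M (annulus N R) :=
    (hMcont.continuousOn.integrableOn_compact
      (isCompact_closedBall (0 : EuclideanSpace ℝ (Fin N)) (2 * R))).mono_set
      fun x hx => mem_closedBall_zero_iff.2 hx.2.le
  set V : EuclideanSpace ℝ (Fin N) → EuclideanSpace ℝ (Fin N) :=
    fun y => (u y ^ (-(2 * t + 1)) * η y ^ (2 * m)) • ω₁ y • gradient u y
  have hV : ContDiff ℝ 1 V :=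
    (((hupow _).mul (hη.pow _)).of_le one_le_two).smul (hω₁.smul (contDiff_gradient hu))
  have hVc : HasCompactSupport V :=
    ((hηpow (2 * m) (by omega)).mul_left (f := fun y => u y ^ (-(2 * t + 1)))).smul_right
  have hpoint (x) : ω₁ x * ‖gradient (fun y => u y ^ (-t) * η y ^ m) x‖ ^ 2 -
        p * ω₂ x * u x ^ (-p - 1) * (u x ^ (-t) * η x ^ m) ^ 2 + l * vdiv V x ≤
      -((p - l) / 2) * a x + C * (L / R) ^ e * (annulus N R).indicator M x := by
    refine (stability_integrand_le hω₁ hω₁pos hu hupos hη hsup hl0 hl hm x).trans ?_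
    have hy := hyoung (ω₁ x) (ω₂ x) (u x) (η x) ‖gradient η x‖ (hω₁pos x) (hω₂pos x) (hupos x)
      (hη0 x) (hη1 x) (norm_nonneg _)
    have hind : C * (M x * ‖gradient η x‖ ^ e) ≤
        C * (L / R) ^ e * (annulus N R).indicator M x := by
      by_cases hx : x ∈ annulus N R
      · rw [Set.indicator_of_mem hx, mul_assoc, mul_comm (M x)]
        have := hM0 x
        have := hηL x
        gcongr
      · rw [Set.indicator_of_notMem hx, hηann x hx]
        simp [zero_rpow he0.ne']
    simp only [ha_def]
    linarith
  have hGcont : Continuous fun x => ω₁ x * ‖gradient (fun y => u y ^ (-t) * η y ^ m) x‖ ^ 2 :=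
    hω₁.continuous.mul ((contDiff_gradient hψ).continuous.norm.pow 2)
  have hGc : HasCompactSupport
      fun x => ω₁ x * ‖gradient (fun y => u y ^ (-t) * η y ^ m) x‖ ^ 2 :=
    HasCompactSupport.mul_left ((hψc.fderiv ℝ).comp_left
      (g := fun A => ‖(InnerProductSpace.toDual ℝ (EuclideanSpace ℝ (Fin N))).symm A‖ ^ 2)
      (by simp))
  have hG := hGcont.integrable_of_hasCompactSupport (μ := volume) hGc
  have hPint : Integrable fun x =>
      p * ω₂ x * u x ^ (-p - 1) * (u x ^ (-t) * η x ^ m) ^ 2 := by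
    simpa only [ha_def, ← mul_assoc] using haint.const_mul p
  have hVint : Integrable (vdiv V) :=
    (continuous_vdiv hV).integrable_of_hasCompactSupport (hasCompactSupport_vdiv hVc)
  have hIint : Integrable ((annulus N R).indicator M) := hMint.integrable_indicator hannm
  have hint := integral_mono ((hG.sub hPint).add (hVint.const_mul l))
    ((haint.const_mul (-((p - l) / 2))).add (hIint.const_mul (C * (L / R) ^ e))) hpoint
  rw [integral_add' (hG.sub hPint) (hVint.const_mul l), integral_sub' hG hPint,
    integral_add' (haint.const_mul _) (hIint.const_mul _), integral_const_mul, integral_const_mul,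
    integral_const_mul, integral_vdiv_eq_zero hV hVc, integral_indicator hannm] at hint
  have hst := hstab _ hψ hψc
  have hball : ∫ x in Metric.closedBall 0 1, ω₂ x * u x ^ (-p - 1) * (u x ^ (-t)) ^ 2 ≤
      ∫ x, a x := by
    refine le_of_eq_of_le (setIntegral_congr_fun Metric.isClosed_closedBall.measurableSet
      fun x hx => ?_) (setIntegral_le_integral haint (Eventually.of_forall ha0))
    simp [ha_def, hηR x ((mem_closedBall_zero_iff.1 hx).trans hR)]
  have hRe : C * (L / R) ^ e = C * L ^ e * R ^ (-2 * (p + 2 * t + 1) / (p + 1)) := by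
    rw [div_rpow hL hR0.le, show -2 * (p + 2 * t + 1) / (p + 1) = -e by rw [he]; ring,
      rpow_neg hR0.le]
    ring
  rw [hRe] at hint
  refine hball.trans ?_
  rw [mul_assoc, le_inv_mul_iff₀ hδ]
  linarith

theorem stmt_8 (N : ℕ) (hN : 1 ≤ N) (p : ℝ) (hp : 0 < p)
    (ω₁ ω₂ : EuclideanSpace ℝ (Fin N) → ℝ)
    (hω₁ : ContDiff ℝ (⊤ : ℕ∞) ω₁) (hω₂ : ContDiff ℝ (⊤ : ℕ∞) ω₂)
    (hω₁pos : ∀ x, 0 < ω₁ x) (hω₂pos : ∀ x, 0 < ω₂ x)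
    (t : ℝ) (ht1 : 0 < t) (ht2 : t < p + Real.sqrt (p * (p + 1)))
    (hIM : Tendsto (fun R : ℝ =>
      R ^ (-2*(p + 2*t + 1)/(p + 1)) *
        ∫ x in annulus N R, (ω₁ x ^ (p + 2*t + 1) / ω₂ x ^ (2*t)) ^ (1/(p + 1)))
      atTop (nhds 0)) :
    ¬ ∃ u : EuclideanSpace ℝ (Fin N) → ℝ, ContDiff ℝ 2 u ∧ (∀ x, 0 < u x) ∧
      (∀ x, -(ω₂ x * u x ^ (-p)) ≤ -vdiv (fun y => ω₁ y • gradient u y) x) ∧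
      (∀ ψ : EuclideanSpace ℝ (Fin N) → ℝ, ContDiff ℝ 2 ψ → HasCompactSupport ψ →
        ∫ x, p * ω₂ x * u x ^ (-p - 1) * ψ x ^ 2 ≤ ∫ x, ω₁ x * ‖gradient ψ x‖ ^ 2) := by
  rintro ⟨u, hu, hupos, hsup, hstab⟩
  obtain ⟨C, hC⟩ := setIntegral_closedBall_le_mul_setIntegral_annulus hp ht1 ht2
    (hω₁.of_le (by exact_mod_cast le_top)) hω₂.continuous hω₁pos hω₂pos hu hupos hsup hstab
  have hle := ge_of_tendsto (hIM.const_mul C) ((eventually_ge_atTop 1).mono hC)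
  have hpos (x) : 0 < ω₂ x * u x ^ (-p - 1) * (u x ^ (-t)) ^ 2 := by
    have := hω₂pos x
    have := hupos x
    positivity
  have hcont : Continuous fun x => ω₂ x * u x ^ (-p - 1) * (u x ^ (-t)) ^ 2 :=
    (hω₂.continuous.mul (hu.continuous.rpow_const fun x => Or.inl (hupos x).ne')).mul
      ((hu.continuous.rpow_const fun x => Or.inl (hupos x).ne').pow 2)
  have hlt : 0 < ∫ x in Metric.closedBall 0 1, ω₂ x * u x ^ (-p - 1) * (u x ^ (-t)) ^ 2 := by
    rw [setIntegral_pos_iff_support_of_nonneg_ae (Eventually.of_forall fun x => (hpos x).le)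
      (hcont.continuousOn.integrableOn_compact (isCompact_closedBall _ _))]
    rw [Function.support_eq_univ fun x => (hpos x).ne', Set.univ_inter]
    exact Metric.measure_closedBall_pos volume 0 one_pos
  rw [mul_zero] at hle
  exact hlt.not_ge hle
end

section
/- Let N ≥ 1, p > 1, and suppose N < 2 + (4/(p−1))(p + √(p(p−1))). Let ω₁, ω₂ : ℝ^N → ℝ be smooth positive functions such that: ω₂ is bounded on ℝ^N; there is a constant C > 0 with ω₁(x) ≤ C ω₂(x) for all x with |x| sufficiently large; and ∇ω₁(x) · x ≤ 0 for all x with |x| sufficiently large. Then there is no positive stable sub-solution of the equation −div(ω₁ ∇u) = ω₂ u^p in ℝ^N. -/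
open MeasureTheory Filter Real
open scoped RealInnerProductSpace

section Gradient

variable {E : Type*} [NormedAddCommGroup E] [InnerProductSpace ℝ E] [CompleteSpace E]

lemma norm_gradient (f : E → ℝ) (x : E) : ‖gradient f x‖ = ‖fderiv ℝ f x‖ := by
  simp [gradient]

lemma continuous_gradient {f : E → ℝ} (hf : ContDiff ℝ 1 f) : Continuous (gradient f) :=
  (InnerProductSpace.toDual ℝ E).symm.continuous.comp (hf.continuous_fderiv one_ne_zero)

lemma hasCompactSupport_gradient {f : E → ℝ} (hf : HasCompactSupport f) :
    HasCompactSupport (gradient f) :=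
  (hf.fderiv ℝ).comp_left (g := (InnerProductSpace.toDual ℝ E).symm) (map_zero _)

lemma contDiff_gradient_s10 {f : E → ℝ} (hf : ContDiff ℝ 2 f) : ContDiff ℝ 1 (gradient f) :=
  (InnerProductSpace.toDual ℝ E).symm.toContinuousLinearEquiv.contDiff.comp
    (hf.fderiv_right (m := 1) (by norm_num))

lemma gradient_mul {f g : E → ℝ} {x : E} (hf : DifferentiableAt ℝ f x)
    (hg : DifferentiableAt ℝ g x) :
    gradient (fun y => f y * g y) x = g x • gradient f x + f x • gradient g x := by
  simp only [gradient]
  rw [fderiv_fun_mul hf hg]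
  simp [add_comm]

lemma gradient_rpow {f : E → ℝ} {x : E} (hf : DifferentiableAt ℝ f x) (hx : 0 < f x) (t : ℝ) :
    gradient (fun y => f y ^ t) x = (t * f x ^ (t - 1)) • gradient f x := by
  simp only [gradient]
  rw [(hf.hasFDerivAt.rpow_const (p := t) (Or.inl hx.ne')).fderiv]
  simp

lemma gradient_pow {f : E → ℝ} {x : E} (hf : DifferentiableAt ℝ f x) (m : ℕ) :
    gradient (fun y => f y ^ m) x = (m * f x ^ (m - 1)) • gradient f x := by
  simp only [gradient]
  rw [(hf.hasFDerivAt.pow m).fderiv]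
  simp

lemma gradient_eq_zero_of_eventuallyEq_const {f : E → ℝ} {x : E} {c : ℝ}
    (h : f =ᶠ[nhds x] fun _ => c) : gradient f x = 0 := by
  rw [h.gradient_eq]
  simp [gradient]

end Gradient

/-- Cutoff functions at scale `R` with gradient of size `O(1 / R)`. -/
lemma exists_cutoff_s10 (E : Type*) [NormedAddCommGroup E] [InnerProductSpace ℝ E]
    [FiniteDimensional ℝ E] :
    ∃ L : ℝ, 0 ≤ L ∧ ∀ R : ℝ, 0 < R → ∃ φ : E → ℝ, ContDiff ℝ 2 φ ∧ HasCompactSupport φ ∧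
      (∀ x, 0 ≤ φ x) ∧ (∀ x, φ x ≤ 1) ∧ (∀ x, ‖x‖ ≤ R → φ x = 1) ∧
      (∀ x, ‖x‖ < R → gradient φ x = 0) ∧ (∀ x, 2 * R < ‖x‖ → gradient φ x = 0) ∧
      ∀ x, ‖gradient φ x‖ ≤ L / R := by
  let b : ContDiffBump (0 : E) := ⟨1, 2, one_pos, one_lt_two⟩
  obtain ⟨L, hL⟩ := (b.contDiff (n := 1)).lipschitzWith_of_hasCompactSupport b.hasCompactSupport
    one_ne_zero
  refine ⟨L, L.2, fun R hR => ?_⟩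
  have hone : ∀ x : E, ‖x‖ ≤ R → b (R⁻¹ • x) = 1 := fun x hx => by
    apply b.one_of_mem_closedBall
    rw [mem_closedBall_zero_iff, norm_smul, norm_inv, Real.norm_of_nonneg hR.le]
    change R⁻¹ * ‖x‖ ≤ 1
    rw [inv_mul_le_iff₀ hR]
    linarith
  have hzero : ∀ x : E, 2 * R ≤ ‖x‖ → b (R⁻¹ • x) = 0 := fun x hx => by
    apply b.zero_of_le_dist
    rw [dist_zero_right, norm_smul, norm_inv, Real.norm_of_nonneg hR.le]
    change 2 ≤ R⁻¹ * ‖x‖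
    rw [le_inv_mul_iff₀ hR]
    linarith
  refine ⟨fun x => b (R⁻¹ • x), b.contDiff.comp (contDiff_const_smul _), ?_, fun x => b.nonneg,
    fun x => b.le_one, hone, fun x hx => ?_, fun x hx => ?_, fun x => ?_⟩
  · exact b.hasCompactSupport.comp_homeomorph (Homeomorph.smulOfNeZero R⁻¹ (inv_ne_zero hR.ne'))
  · refine gradient_eq_zero_of_eventuallyEq_const (c := 1) ?_
    filter_upwards [continuous_norm.continuousAt.eventually_lt_const hx] with y hy
    exact hone y hy.le
  · refine gradient_eq_zero_of_eventuallyEq_const (c := 0) ?_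
    filter_upwards [continuous_norm.continuousAt.eventually_const_lt hx] with y hy
    exact hzero y hy.le
  · rw [norm_gradient, fderiv_comp_smul, norm_smul, norm_inv, Real.norm_of_nonneg hR.le,
      div_eq_inv_mul]
    gcongr
    exact norm_fderiv_le_of_lipschitz ℝ hL

lemma integral_mul_vdiv {N : ℕ} {V : EuclideanSpace ℝ (Fin N) → EuclideanSpace ℝ (Fin N)}
    {g : EuclideanSpace ℝ (Fin N) → ℝ} (hV : ContDiff ℝ 1 V) (hg : ContDiff ℝ 1 g)
    (hgs : HasCompactSupport g) :
    ∫ x, g x * vdiv V x = - ∫ x, ⟪gradient g x, V x⟫ := by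
  let b := stdOrthonormalBasis ℝ (EuclideanSpace ℝ (Fin N))
  have hV' : Continuous (fderiv ℝ V) := hV.continuous_fderiv one_ne_zero
  have hg' : Continuous (fderiv ℝ g) := hg.continuous_fderiv one_ne_zero
  have hVc := hV.continuous
  have hgc := hg.continuous
  have hfd : ∀ i x, fderiv ℝ (fun y => ⟪b i, V y⟫) x (b i) = ⟪b i, fderiv ℝ V x (b i)⟫ := by
    intro i x
    have := ((innerSL ℝ (b i)).hasFDerivAt.comp x
      (hV.differentiable one_ne_zero x).hasFDerivAt).fderiv
    change fderiv ℝ ((innerSL ℝ (b i)) ∘ V) x (b i) = _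
    rw [this]
    simp
  have hI1 : ∀ i, Integrable fun x => g x * ⟪b i, fderiv ℝ V x (b i)⟫ := fun i =>
    Continuous.integrable_of_hasCompactSupport (by fun_prop) hgs.mul_right
  have hI2 : ∀ i, Integrable fun x => fderiv ℝ g x (b i) * ⟪b i, V x⟫ := fun i =>
    Continuous.integrable_of_hasCompactSupport (by fun_prop) (hgs.fderiv_apply ℝ (b i)).mul_right
  have hI3 : ∀ i, Integrable fun x => g x * ⟪b i, V x⟫ := fun i =>
    Continuous.integrable_of_hasCompactSupport (by fun_prop) hgs.mul_right
  have key : ∀ i, ∫ x, g x * ⟪b i, fderiv ℝ V x (b i)⟫ =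
      - ∫ x, fderiv ℝ g x (b i) * ⟪b i, V x⟫ := by
    intro i
    have hd : Differentiable ℝ fun y => ⟪b i, V y⟫ :=
      (differentiable_const _).inner ℝ (hV.differentiable one_ne_zero)
    have := integral_mul_fderiv_eq_neg_fderiv_mul_of_integrable (μ := volume)
      (f := g) (g := fun y => ⟪b i, V y⟫) (v := b i) (hI2 i)
      (by simpa only [hfd] using hI1 i) (hI3 i)
      (fun x _ => hg.differentiable one_ne_zero x) (fun x _ => hd x)
    simpa only [hfd] using this
  have h1 : ∀ x, g x * vdiv V x = ∑ i, g x * ⟪b i, fderiv ℝ V x (b i)⟫ := by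
    intro x
    rw [vdiv, LinearMap.trace_eq_sum_inner _ b, Finset.mul_sum]
    rfl
  have h2 : ∀ x, ⟪gradient g x, V x⟫ = ∑ i, fderiv ℝ g x (b i) * ⟪b i, V x⟫ := by
    intro x
    rw [← b.sum_inner_mul_inner]
    simp only [inner_gradient_left]
  simp only [h1, h2]
  rw [integral_finsetSum _ fun i _ => hI1 i, integral_finsetSum _ fun i _ => hI2 i,
    ← Finset.sum_neg_distrib]
  exact Finset.sum_congr rfl fun i _ => key i

lemma exists_exponent {p n : ℝ} (hp : 1 < p)
    (hn : n < 2 + 4 / (p - 1) * (p + √(p * (p - 1)))) :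
    ∃ t l : ℝ, p < t ∧ l < p ∧ t ^ 2 < l * (2 * t - 1) ∧ n < 2 * (1 + 2 * t / (p - 1)) := by
  have hp1 : 0 < p - 1 := by linarith
  have hs : 0 < √(p * (p - 1)) := Real.sqrt_pos.2 (by positivity)
  have hs2 : √(p * (p - 1)) ^ 2 = p * (p - 1) := Real.sq_sqrt (by positivity)
  set s := √(p * (p - 1))
  have h1 : (n - 2) * (p - 1) / 4 < p + s := by
    have : n - 2 < 4 * (p + s) / (p - 1) := by
      rw [mul_comm_div, mul_div_assoc'] at hn
      linarith
    rw [lt_div_iff₀ hp1] at this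
    linarith
  obtain ⟨t, ht1, ht2⟩ := exists_between (max_lt (show p < p + s by linarith) h1)
  obtain ⟨htp, htn⟩ := max_lt_iff.1 ht1
  have h2t : 0 < 2 * t - 1 := by linarith
  have hq : t ^ 2 / (2 * t - 1) < p := by
    rw [div_lt_iff₀ h2t]
    nlinarith
  obtain ⟨l, hl1, hl2⟩ := exists_between hq
  refine ⟨t, l, htp, hl2, (div_lt_iff₀ h2t).1 hl1, ?_⟩
  have : n - 2 < 4 * t / (p - 1) := by
    rw [lt_div_iff₀ hp1]
    linarith
  have e : 2 * (1 + 2 * t / (p - 1)) = 2 + 4 * t / (p - 1) := by ring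
  linarith

lemma norm_sq_le_of_sq_lt {E : Type*} [NormedAddCommGroup E] [InnerProductSpace ℝ E] {t l : ℝ}
    (h : t ^ 2 < l * (2 * t - 1)) (a b : E) :
    ‖t • a + b‖ ^ 2 ≤ l * ((2 * t - 1) * ‖a‖ ^ 2 + 2 * ⟪a, b⟫) +
      (1 + (l - t) ^ 2 / (l * (2 * t - 1) - t ^ 2)) * ‖b‖ ^ 2 := by
  set δ := l * (2 * t - 1) - t ^ 2 with hδ
  have hδ0 : 0 < δ := by linarith
  have h0 : 0 ≤ ‖δ • a + (l - t) • b‖ ^ 2 / δ := by positivity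
  rw [norm_add_sq_real] at h0 ⊢
  simp only [norm_smul, mul_pow, inner_smul_left, inner_smul_right, Real.norm_eq_abs, sq_abs,
    RCLike.conj_to_real] at h0 ⊢
  have e : (δ ^ 2 * ‖a‖ ^ 2 + 2 * (δ * ((l - t) * ⟪a, b⟫)) + (l - t) ^ 2 * ‖b‖ ^ 2) / δ =
      δ * ‖a‖ ^ 2 + 2 * (l - t) * ⟪a, b⟫ + (l - t) ^ 2 / δ * ‖b‖ ^ 2 := by
    field_simp
  have h1 : 0 ≤ δ * ‖a‖ ^ 2 + 2 * (l - t) * ⟪a, b⟫ + (l - t) ^ 2 / δ * ‖b‖ ^ 2 := by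
    rw [← e]
    convert h0 using 2
    ring
  have e2 : δ * ‖a‖ ^ 2 = (l * (2 * t - 1) - t ^ 2) * ‖a‖ ^ 2 := by rw [hδ]
  rw [e2] at h1
  nlinarith

/-- Caccioppoli-type estimate for stable sub-solutions. -/
lemma integral_le_of_stable {N : ℕ} {p t l : ℝ} (hl0 : 0 ≤ l)
    (htl : t ^ 2 < l * (2 * t - 1))
    {ω₁ ω₂ u η : EuclideanSpace ℝ (Fin N) → ℝ}
    (hω₁ : ContDiff ℝ 1 ω₁) (hω₂ : Continuous ω₂) (hω₁pos : ∀ x, 0 < ω₁ x)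
    (hu : ContDiff ℝ 2 u) (hupos : ∀ x, 0 < u x)
    (hsub : ∀ x, -vdiv (fun y => ω₁ y • gradient u y) x ≤ ω₂ x * u x ^ p)
    (hstab : ∀ ψ : EuclideanSpace ℝ (Fin N) → ℝ, ContDiff ℝ 2 ψ → HasCompactSupport ψ →
        ∫ x, p * ω₂ x * u x ^ (p - 1) * ψ x ^ 2 ≤ ∫ x, ω₁ x * ‖gradient ψ x‖ ^ 2)
    (hη : ContDiff ℝ 2 η) (hηs : HasCompactSupport η) :
    (p - l) * ∫ x, ω₂ x * u x ^ (2 * t + (p - 1)) * η x ^ 2 ≤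
      (1 + (l - t) ^ 2 / (l * (2 * t - 1) - t ^ 2)) *
        ∫ x, ω₁ x * u x ^ (2 * t) * ‖gradient η x‖ ^ 2 := by
  have hrpow : ∀ r : ℝ, ContDiff ℝ 2 fun x => u x ^ r := fun r =>
    hu.rpow_const_of_ne fun x => (hupos x).ne'
  have hrc : ∀ r : ℝ, Continuous fun x => u x ^ r := fun r => (hrpow r).continuous
  have hω₁c := hω₁.continuous
  have hgu : Continuous (gradient u) := continuous_gradient (hu.of_le one_le_two)
  have hgη : Continuous (gradient η) := continuous_gradient (hη.of_le one_le_two)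
  have hgηs : HasCompactSupport (gradient η) :=
    hasCompactSupport_gradient hηs
  have hud : ∀ x, DifferentiableAt ℝ u x := hu.differentiable two_ne_zero
  have hηd : ∀ x, DifferentiableAt ℝ η x := hη.differentiable two_ne_zero
  have hη2 : ContDiff ℝ 2 fun x => η x ^ 2 := hη.pow 2
  have hη2s : HasCompactSupport fun x => η x ^ 2 :=
    hηs.comp_left (g := fun y : ℝ => y ^ 2) (by norm_num)
  set ψ : EuclideanSpace ℝ (Fin N) → ℝ := fun x => u x ^ t * η x with hψ
  set g : EuclideanSpace ℝ (Fin N) → ℝ := fun x => u x ^ (2 * t - 1) * η x ^ 2 with hg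
  have hψ2 : ContDiff ℝ 2 ψ := (hrpow t).mul hη
  have hg2 : ContDiff ℝ 2 g := (hrpow _).mul hη2
  have hψs : HasCompactSupport ψ := hηs.mul_left
  have hgs : HasCompactSupport g := hη2s.mul_left
  have hV : ContDiff ℝ 1 fun y => ω₁ y • gradient u y := hω₁.smul (contDiff_gradient_s10 hu)
  have hvd : Continuous (vdiv fun y => ω₁ y • gradient u y) := by
    have h := hV.continuous_fderiv one_ne_zero
    have := (LinearMap.continuous_of_finiteDimensional
      ((LinearMap.trace ℝ (EuclideanSpace ℝ (Fin N))) ∘ₗ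
        (ContinuousLinearMap.coeLM ℝ : (EuclideanSpace ℝ (Fin N) →L[ℝ] EuclideanSpace ℝ (Fin N))
          →ₗ[ℝ] _))).comp h
    exact this
  have hgc := hg2.continuous
  have hD : Integrable fun x => ω₂ x * u x ^ (2 * t + (p - 1)) * η x ^ 2 :=
    Continuous.integrable_of_hasCompactSupport
      ((hω₂.mul (hrc _)).mul hη2.continuous) hη2s.mul_left
  have hE : Integrable fun x => ω₁ x * u x ^ (2 * t) * ‖gradient η x‖ ^ 2 :=
    Continuous.integrable_of_hasCompactSupport
      ((hω₁c.mul (hrc _)).mul (hgη.norm.pow 2))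
      (hgηs.comp_left (g := fun y => ‖y‖ ^ 2) (by norm_num)).mul_left
  have hggc : Continuous (gradient g) := continuous_gradient (hg2.of_le one_le_two)
  have hggs : HasCompactSupport (gradient g) :=
    hasCompactSupport_gradient hgs
  have hG : Integrable fun x => ⟪gradient g x, ω₁ x • gradient u x⟫ :=
    Continuous.integrable_of_hasCompactSupport (hggc.inner (hω₁c.smul hgu)) <| by
      refine hggs.mono' fun x hx => subset_tsupport _ ?_
      intro h0
      exact hx (by simp [show gradient g x = 0 from h0])
  have weak : ∫ x, ⟪gradient g x, ω₁ x • gradient u x⟫ ≤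
      ∫ x, ω₂ x * u x ^ (2 * t + (p - 1)) * η x ^ 2 := by
    have h := integral_mul_vdiv hV (hg2.of_le one_le_two) hgs
    rw [← neg_eq_iff_eq_neg.2 h, ← integral_neg]
    refine integral_mono (Continuous.integrable_of_hasCompactSupport (hgc.mul hvd).neg
      hgs.mul_right.neg) hD fun x => ?_
    have hx := hupos x
    have hg0 : 0 ≤ g x := by simp only [hg]; positivity
    have e : u x ^ (2 * t + (p - 1)) = u x ^ p * u x ^ (2 * t - 1) := by
      rw [← rpow_add hx]; congr 1; ring
    have := mul_le_mul_of_nonneg_left (hsub x) hg0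
    simp only
    rw [e]
    calc -(g x * vdiv (fun y => ω₁ y • gradient u y) x)
        = g x * -vdiv (fun y => ω₁ y • gradient u y) x := by ring
      _ ≤ _ := this
      _ = _ := by simp only [hg]; ring
  have stab : p * ∫ x, ω₂ x * u x ^ (2 * t + (p - 1)) * η x ^ 2 ≤
      ∫ x, ω₁ x * ‖gradient ψ x‖ ^ 2 := by
    rw [← integral_const_mul]
    refine le_of_eq_of_le (integral_congr_ae (ae_of_all _ fun x => ?_)) (hstab ψ hψ2 hψs)
    have hx := hupos x
    have e : u x ^ (2 * t + (p - 1)) = u x ^ (p - 1) * (u x ^ t) ^ 2 := by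
      rw [← rpow_mul_natCast hx.le, ← rpow_add hx]; congr 1; push_cast; ring
    simp only [hψ, e]
    ring
  have point : ∀ x, ω₁ x * ‖gradient ψ x‖ ^ 2 ≤
      l * ⟪gradient g x, ω₁ x • gradient u x⟫ +
      (1 + (l - t) ^ 2 / (l * (2 * t - 1) - t ^ 2)) *
        (ω₁ x * u x ^ (2 * t) * ‖gradient η x‖ ^ 2) := by
    intro x
    have hx := hupos x
    set a := (u x ^ (t - 1) * η x) • gradient u x with ha
    set b := u x ^ t • gradient η x with hb
    have h1 : gradient ψ x = t • a + b := by
      rw [hψ, gradient_mul ((hrpow t).differentiable two_ne_zero x) (hηd x),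
        gradient_rpow (hud x) hx, ha, hb, smul_smul, smul_smul]
      congr 2
      ring
    have e1 : u x ^ (2 * t - 1 - 1) = (u x ^ (t - 1)) ^ 2 := by
      rw [← rpow_mul_natCast hx.le]; congr 1; push_cast; ring
    have e2 : u x ^ (2 * t - 1) = u x ^ (t - 1) * u x ^ t := by
      rw [← rpow_add hx]; congr 1; ring
    have e3 : u x ^ (2 * t) = (u x ^ t) ^ 2 := by
      rw [← rpow_mul_natCast hx.le]; congr 1; push_cast; ring
    have h2 : ⟪gradient g x, ω₁ x • gradient u x⟫ =
        ω₁ x * ((2 * t - 1) * ‖a‖ ^ 2 + 2 * ⟪a, b⟫) := by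
      rw [hg, gradient_mul ((hrpow _).differentiable two_ne_zero x)
        (hη2.differentiable two_ne_zero x), gradient_rpow (hud x) hx, gradient_pow (hηd x),
        ha, hb, e1, e2]
      simp only [norm_smul, mul_pow, inner_smul_left, inner_smul_right, Real.norm_eq_abs, sq_abs,
        RCLike.conj_to_real, inner_add_left, real_inner_self_eq_norm_sq, Nat.cast_ofNat,
        Nat.add_one_sub_one, pow_one, real_inner_comm (gradient η x) (gradient u x)]
      ring
    have h3 : ω₁ x * u x ^ (2 * t) * ‖gradient η x‖ ^ 2 = ω₁ x * ‖b‖ ^ 2 := by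
      rw [hb, norm_smul, mul_pow, Real.norm_eq_abs, sq_abs, e3]
      ring
    rw [h1, h2, h3]
    have := mul_le_mul_of_nonneg_left (norm_sq_le_of_sq_lt htl a b) (hω₁pos x).le
    linarith
  have hψg : Integrable fun x => ω₁ x * ‖gradient ψ x‖ ^ 2 := by
    have hψc : Continuous (gradient ψ) := continuous_gradient (hψ2.of_le one_le_two)
    have hψs' : HasCompactSupport (gradient ψ) :=
      hasCompactSupport_gradient hψs
    exact Continuous.integrable_of_hasCompactSupport (hω₁c.mul (hψc.norm.pow 2))
      (hψs'.comp_left (g := fun y => ‖y‖ ^ 2) (by norm_num)).mul_left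
  have hint := integral_mono hψg ((hG.const_mul l).add (hE.const_mul _)) point
  rw [integral_add' (hG.const_mul l) (hE.const_mul _), integral_const_mul,
    integral_const_mul] at hint
  have := mul_le_mul_of_nonneg_left weak hl0
  linarith

/-- A form of Young's inequality adapted to powers of a cutoff function. -/
lemma young_cutoff {r s ε v f G : ℝ} {m : ℕ} (hr : 0 < r) (hs : 0 ≤ s) (hε : 0 < ε) (hv : 0 < v)
    (hf0 : 0 ≤ f) (hf1 : f ≤ 1) (hG : 0 ≤ G) (hm : 1 + s / r ≤ m) :
    v ^ s * f ^ (2 * (m - 1)) * G ≤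
      ε * (v ^ (s + r) * f ^ (2 * m)) + ε ^ (-(s / r)) * G ^ (1 + s / r) := by
  have hsr : 0 ≤ s / r := by positivity
  have hm1 : 1 ≤ m := by
    have : (1 : ℝ) ≤ m := by linarith
    exact_mod_cast this
  rcases le_total G (ε * (v ^ r * f ^ 2)) with h | h
  · have h1 : v ^ s * f ^ (2 * (m - 1)) * G ≤
        v ^ s * f ^ (2 * (m - 1)) * (ε * (v ^ r * f ^ 2)) := by gcongr
    have h2 : v ^ s * f ^ (2 * (m - 1)) * (ε * (v ^ r * f ^ 2)) =
        ε * (v ^ (s + r) * f ^ (2 * m)) := by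
      obtain ⟨k, rfl⟩ := Nat.exists_eq_add_of_le hm1
      rw [rpow_add hv, Nat.add_sub_cancel_left]
      ring
    have h3 : 0 ≤ ε ^ (-(s / r)) * G ^ (1 + s / r) := by positivity
    linarith
  · have hf : f ^ (2 * (m - 1)) ≤ (f ^ 2) ^ (s / r) := by
      rcases hf0.eq_or_lt with rfl | hfpos
      · rcases hs.eq_or_lt with rfl | hspos
        · simpa using pow_le_one₀ (n := 2 * (m - 1)) (le_refl (0 : ℝ)) zero_le_one
        · have : 1 < m := by
            have h0 : 0 < s / r := by positivity
            have : (1 : ℝ) < m := by linarith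
            exact_mod_cast this
          rw [zero_pow (by omega)]
          positivity
      · rw [pow_mul, ← rpow_natCast (f ^ 2) (m - 1)]
        apply rpow_le_rpow_of_exponent_ge (by positivity) (pow_le_one₀ hf0 hf1)
        rw [Nat.cast_sub hm1]
        push_cast
        linarith
    have h1 : v ^ s * (f ^ 2) ^ (s / r) ≤ ε ^ (-(s / r)) * G ^ (s / r) := by
      have e : v ^ s * (f ^ 2) ^ (s / r) = (v ^ r * f ^ 2) ^ (s / r) := by
        rw [mul_rpow (by positivity) (by positivity), ← rpow_mul hv.le, mul_div_cancel₀ _ hr.ne']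
      have e' : ε ^ (-(s / r)) * G ^ (s / r) = (G / ε) ^ (s / r) := by
        rw [div_rpow hG hε.le, rpow_neg hε.le, inv_mul_eq_div]
      rw [e, e']
      apply rpow_le_rpow (by positivity) _ hsr
      rw [le_div_iff₀ hε]
      linarith
    have h2 : G ^ (1 + s / r) = G ^ (s / r) * G := by
      rw [add_comm, rpow_add_one' hG (by positivity)]
    have h3 : 0 ≤ ε * (v ^ (s + r) * f ^ (2 * m)) := by positivity
    calc v ^ s * f ^ (2 * (m - 1)) * G ≤ v ^ s * (f ^ 2) ^ (s / r) * G := by gcongr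
      _ ≤ ε ^ (-(s / r)) * G ^ (s / r) * G := by gcongr
      _ ≤ _ := by rw [h2]; linarith

lemma exists_lt_of_rpow_decay {N : ℕ} {q A d : ℝ} (hq : (N : ℝ) < 2 * q) (hd : 0 < d) (L R₁ : ℝ) :
    ∃ R, R₁ ≤ R ∧ 0 < R ∧ 1 ≤ R ∧ A * ((L / R) ^ 2) ^ q * (2 * R) ^ N < d := by
  have hlim : Tendsto (fun R : ℝ => A * (L ^ 2) ^ q * 2 ^ N * R ^ (-(2 * q - N))) atTop
      (nhds 0) := by
    simpa using (tendsto_rpow_neg_atTop (sub_pos.2 hq)).const_mul (A * (L ^ 2) ^ q * 2 ^ N)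
  obtain ⟨R, hR, hR1, hR2⟩ := ((hlim.eventually_lt_const hd).and
    ((eventually_ge_atTop R₁).and (eventually_ge_atTop 1))).exists
  have hR0 : 0 < R := by linarith
  refine ⟨R, hR1, hR0, hR2, lt_of_eq_of_lt ?_ hR⟩
  have e : R ^ (-(2 * q - N)) = ((R ^ 2) ^ q)⁻¹ * R ^ N := by
    rw [← rpow_natCast R 2, ← rpow_mul hR0.le, ← rpow_neg hR0.le, ← rpow_natCast R N,
      ← rpow_add hR0]
    congr 1
    push_cast
    ring
  rw [e, div_pow, div_rpow (by positivity) (by positivity), mul_pow]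
  ring

theorem stmt_10 (N : ℕ) (hN : 1 ≤ N) (p : ℝ) (hp : 1 < p)
    (hdim : (N : ℝ) < 2 + 4/(p - 1) * (p + Real.sqrt (p * (p - 1))))
    (ω₁ ω₂ : EuclideanSpace ℝ (Fin N) → ℝ)
    (hω₁ : ContDiff ℝ (⊤ : ℕ∞) ω₁) (hω₂ : ContDiff ℝ (⊤ : ℕ∞) ω₂)
    (hω₁pos : ∀ x, 0 < ω₁ x) (hω₂pos : ∀ x, 0 < ω₂ x)
    (hbdd : ∃ M : ℝ, ∀ x, ω₂ x ≤ M)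
    (hcomp : ∃ C : ℝ, 0 < C ∧ ∃ R₀ : ℝ, ∀ x : EuclideanSpace ℝ (Fin N), R₀ ≤ ‖x‖ → ω₁ x ≤ C * ω₂ x)
    (hmono : ∃ R₀ : ℝ, ∀ x : EuclideanSpace ℝ (Fin N), R₀ ≤ ‖x‖ → ⟪gradient ω₁ x, x⟫ ≤ 0) :
    ¬ ∃ u : EuclideanSpace ℝ (Fin N) → ℝ, ContDiff ℝ 2 u ∧ (∀ x, 0 < u x) ∧
      (∀ x, -vdiv (fun y => ω₁ y • gradient u y) x ≤ ω₂ x * u x ^ p) ∧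
      (∀ ψ : EuclideanSpace ℝ (Fin N) → ℝ, ContDiff ℝ 2 ψ → HasCompactSupport ψ →
        ∫ x, p * ω₂ x * u x ^ (p - 1) * ψ x ^ 2 ≤ ∫ x, ω₁ x * ‖gradient ψ x‖ ^ 2) := by
  rintro ⟨u, hu, hupos, hsub, hstab⟩
  obtain ⟨M, hM⟩ := hbdd
  obtain ⟨C, hC, R₀, hcomp⟩ := hcomp
  obtain ⟨t, l, htp, hlp, htl, hNt⟩ := exists_exponent hp hdim
  have hM0 : 0 < M := (hω₂pos 0).trans_le (hM 0)
  have hr : 0 < p - 1 := by linarith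
  have ht : 0 < t := by linarith
  have hl : 0 ≤ l := by
    by_contra! h
    nlinarith [sq_nonneg t]
  obtain ⟨L, hL, hcut⟩ := exists_cutoff_s10 (EuclideanSpace ℝ (Fin N))
  obtain ⟨m, hm⟩ := exists_nat_ge (1 + 2 * t / (p - 1))
  have hm0 : 0 < m := by
    have : (0 : ℝ) < m := lt_of_lt_of_le (by positivity) hm
    exact_mod_cast this
  set K := 1 + (l - t) ^ 2 / (l * (2 * t - 1) - t ^ 2) with hK
  have hK0 : 0 < K := by
    have : 0 < l * (2 * t - 1) - t ^ 2 := by linarith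
    positivity
  set q := 1 + 2 * t / (p - 1) with hq
  have hpl : 0 < p - l := by linarith
  set ε := (p - l) / (2 * K * C * (m : ℝ) ^ 2) with hε
  have hε0 : 0 < ε := by positivity
  set B := K * (C * (m : ℝ) ^ 2) * (ε ^ (-(2 * t / (p - 1))) * M) with hB
  set β := volume.real (Metric.ball (0 : EuclideanSpace ℝ (Fin N)) 1) with hβ
  have hrc : ∀ r : ℝ, Continuous fun x => u x ^ r := fun r =>
    hu.continuous.rpow_const fun x => Or.inl (hupos x).ne'
  have hF : Continuous fun x => ω₂ x * u x ^ (2 * t + (p - 1)) := hω₂.continuous.mul (hrc _)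
  have hFpos : ∀ x, 0 < ω₂ x * u x ^ (2 * t + (p - 1)) := fun x =>
    mul_pos (hω₂pos x) (rpow_pos_of_pos (hupos x) _)
  set d := ∫ x in Metric.closedBall (0 : EuclideanSpace ℝ (Fin N)) 1,
    ω₂ x * u x ^ (2 * t + (p - 1)) with hd
  have hd0 : 0 < d := by
    rw [hd, setIntegral_pos_iff_support_of_nonneg_ae (ae_of_all _ fun x => (hFpos x).le)
      (hF.continuousOn.integrableOn_compact (isCompact_closedBall _ _))]
    rw [Function.support_eq_univ fun x => (hFpos x).ne', Set.univ_inter]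
    exact Metric.measure_closedBall_pos _ _ one_pos
  obtain ⟨R, hRR₀, hR, hR1, hsmall⟩ :=
    exists_lt_of_rpow_decay (A := 2 / (p - l) * (B * β)) hNt hd0 L R₀
  obtain ⟨φ, hφ, hφs, hφ0, hφ1, hφone, hφin, hφout, hφL⟩ := hcut R hR
  have hη : ContDiff ℝ 2 fun x => φ x ^ m := hφ.pow m
  have hηs : HasCompactSupport fun x => φ x ^ m :=
    hφs.comp_left (g := fun y : ℝ => y ^ m) (zero_pow hm0.ne')
  have hcac := integral_le_of_stable hl htl (hω₁.of_le (by exact_mod_cast le_top))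
    hω₂.continuous hω₁pos hu hupos hsub hstab hη hηs
  have hη2s : HasCompactSupport fun x => (φ x ^ m) ^ 2 :=
    hηs.comp_left (g := fun y : ℝ => y ^ 2) (by norm_num)
  have hD : Integrable fun x => ω₂ x * u x ^ (2 * t + (p - 1)) * (φ x ^ m) ^ 2 :=
    Continuous.integrable_of_hasCompactSupport (hF.mul (hη.continuous.pow 2)) hη2s.mul_left
  set S := Metric.closedBall (0 : EuclideanSpace ℝ (Fin N)) (2 * R) with hS
  have hSint : Integrable (S.indicator fun _ => ((L / R) ^ 2) ^ q) :=
    (integrable_indicator_iff Metric.isClosed_closedBall.measurableSet).2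
      (integrableOn_const (isCompact_closedBall _ _).measure_lt_top.ne)
  have hE : Integrable fun x => ω₁ x * u x ^ (2 * t) * ‖gradient (fun x => φ x ^ m) x‖ ^ 2 := by
    have hc : Continuous (gradient fun x => φ x ^ m) := continuous_gradient (hη.of_le one_le_two)
    have hs : HasCompactSupport (gradient fun x => φ x ^ m) :=
      hasCompactSupport_gradient hηs
    exact Continuous.integrable_of_hasCompactSupport
      ((hω₁.continuous.mul (hrc _)).mul (hc.norm.pow 2))
      (hs.comp_left (g := fun y => ‖y‖ ^ 2) (by norm_num)).mul_left
  have point : ∀ x, ω₁ x * u x ^ (2 * t) * ‖gradient (fun x => φ x ^ m) x‖ ^ 2 ≤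
      C * (m : ℝ) ^ 2 * ε * (ω₂ x * u x ^ (2 * t + (p - 1)) * (φ x ^ m) ^ 2) +
      C * (m : ℝ) ^ 2 * (ε ^ (-(2 * t / (p - 1))) * M) *
        S.indicator (fun _ => ((L / R) ^ 2) ^ q) x := by
    intro x
    have hux := hupos x
    have hωx := hω₂pos x
    have hφx := hφ0 x
    have hgr : gradient (fun x => φ x ^ m) x = (m * φ x ^ (m - 1)) • gradient φ x :=
      gradient_pow (hφ.differentiable two_ne_zero x) m
    by_cases hx : gradient φ x = 0
    · rw [hgr, hx, smul_zero, norm_zero]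
      have : 0 ≤ S.indicator (fun _ => ((L / R) ^ 2) ^ q) x :=
        Set.indicator_nonneg (fun _ _ => by positivity) x
      have : ω₁ x * u x ^ (2 * t) * 0 ^ 2 = 0 := by ring
      rw [this]
      positivity
    have hxS : x ∈ S := by
      rw [hS, mem_closedBall_zero_iff]
      by_contra! h
      exact hx (hφout x h)
    have hxR : R ≤ ‖x‖ := by
      by_contra! h
      exact hx (hφin x h)
    have hy := young_cutoff (r := p - 1) (s := 2 * t) (G := ‖gradient φ x‖ ^ 2) hr (by positivity)
      hε0 hux hφx (hφ1 x) (by positivity) hm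
    rw [Set.indicator_of_mem hxS, hgr, norm_smul, Real.norm_eq_abs, mul_pow, sq_abs]
    have hGq : (‖gradient φ x‖ ^ 2) ^ q ≤ ((L / R) ^ 2) ^ q := by
      gcongr
      exact hφL x
    calc ω₁ x * u x ^ (2 * t) * ((m * φ x ^ (m - 1)) ^ 2 * ‖gradient φ x‖ ^ 2)
        ≤ (C * ω₂ x) * u x ^ (2 * t) * ((m * φ x ^ (m - 1)) ^ 2 * ‖gradient φ x‖ ^ 2) := by
          gcongr
          exact hcomp x (hRR₀.trans hxR)
      _ = C * (m : ℝ) ^ 2 * ω₂ x *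
          (u x ^ (2 * t) * φ x ^ (2 * (m - 1)) * ‖gradient φ x‖ ^ 2) := by ring
      _ ≤ C * (m : ℝ) ^ 2 * ω₂ x * (ε * (u x ^ (2 * t + (p - 1)) * φ x ^ (2 * m)) +
          ε ^ (-(2 * t / (p - 1))) * (‖gradient φ x‖ ^ 2) ^ q) := by gcongr
      _ = C * (m : ℝ) ^ 2 * ε * (ω₂ x * u x ^ (2 * t + (p - 1)) * (φ x ^ m) ^ 2) +
          C * (m : ℝ) ^ 2 * (ε ^ (-(2 * t / (p - 1))) * ω₂ x) * (‖gradient φ x‖ ^ 2) ^ q := by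
          ring
      _ ≤ _ := by
          gcongr
          exact hM x
  have hint := integral_mono hE ((hD.const_mul _).add (hSint.const_mul _)) point
  rw [integral_add' (hD.const_mul _) (hSint.const_mul _), integral_const_mul,
    integral_const_mul, integral_indicator Metric.isClosed_closedBall.measurableSet,
    setIntegral_const, smul_eq_mul, Measure.addHaar_real_closedBall _ _ (by positivity),
    finrank_euclideanSpace_fin] at hint
  set D := ∫ x, ω₂ x * u x ^ (2 * t + (p - 1)) * (φ x ^ m) ^ 2 with hDdef
  have hdD : d ≤ D := by
    rw [hd, ← integral_indicator Metric.isClosed_closedBall.measurableSet]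
    refine integral_mono ((integrable_indicator_iff
      Metric.isClosed_closedBall.measurableSet).2
      (hF.continuousOn.integrableOn_compact (isCompact_closedBall _ _))) hD fun x => ?_
    by_cases hx : x ∈ Metric.closedBall (0 : EuclideanSpace ℝ (Fin N)) 1
    · rw [Set.indicator_of_mem hx]
      rw [mem_closedBall_zero_iff] at hx
      simp [hφone x (hx.trans hR1)]
    · rw [Set.indicator_of_notMem hx]
      exact mul_nonneg (hFpos x).le (by positivity)
  have h1 := hcac.trans (mul_le_mul_of_nonneg_left hint hK0.le)
  have e1 : K * (C * (m : ℝ) ^ 2 * ε * D) = (p - l) / 2 * D := by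
    rw [hε]
    field_simp
  rw [mul_add, e1] at h1
  have h2 : D ≤ 2 / (p - l) * (B * β) * ((L / R) ^ 2) ^ q * (2 * R) ^ N := by
    have : (p - l) / 2 * D ≤ B * β * ((L / R) ^ 2) ^ q * (2 * R) ^ N := by
      rw [hB]
      nlinarith
    calc D = 2 / (p - l) * ((p - l) / 2 * D) := by field_simp
      _ ≤ 2 / (p - l) * (B * β * ((L / R) ^ 2) ^ q * (2 * R) ^ N) := by gcongr
      _ = _ := by ring
  linarith
end
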